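/- Let n ≥ 1 and consider an instance with n agents having additive nonnegative valuations over a finite set of items, in which all but (at most) one of the agents have the same valuation function. Then an MMS allocation exists: there is an allocation A = (A_1,…,A_n) with v^i(A_i) ≥ MMS^i for every agent i. -/

import Mathlib

/-- The total value of the bundle given to agent `j` by allocation/partition `f`. -/
noncomputable def bundleVal {M : Type*} [Fintype M] {n : ℕ} (v : M → ℝ)
    (f : M → Fin n) (j : Fin n) : ℝ :=
  ∑ e ∈ Finset.univ.filter (fun e => f e = j), v e

/-- The maximin share: max over partitions into `n` bundles of the min bundle value. -/
noncomputable def MMS {M : Type*} [Fintype M] [DecidableEq M] (n : ℕ) [NeZero n]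
    (v : M → ℝ) : ℝ :=
  Finset.univ.sup' Finset.univ_nonempty fun f : M → Fin n =>
    Finset.univ.inf' Finset.univ_nonempty fun j => bundleVal v f j

/-- The minimax share: min over partitions into `n` bundles of the max bundle value. -/
noncomputable def mmS {M : Type*} [Fintype M] [DecidableEq M] (n : ℕ) [NeZero n]
    (v : M → ℝ) : ℝ :=
  Finset.univ.inf' Finset.univ_nonempty fun f : M → Fin n =>
    Finset.univ.sup' Finset.univ_nonempty fun j => bundleVal v f j

/-- The proportional share: total value divided by the number `n` of agents. -/
noncomputable def PS {M : Type*} [Fintype M] (n : ℕ) (v : M → ℝ) : ℝ :=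
  (∑ e, v e) / n

section Shares

variable {M : Type*} [Fintype M] {n : ℕ}

theorem sum_bundleVal (v : M → ℝ) (f : M → Fin n) : ∑ j, bundleVal v f j = ∑ e, v e :=
  Finset.sum_fiberwise _ _ _

theorem bundleVal_perm_comp (v : M → ℝ) (f : M → Fin n) (σ : Equiv.Perm (Fin n)) (j : Fin n) :
    bundleVal v (σ ∘ f) j = bundleVal v f (σ.symm j) := by
  simp only [bundleVal, Function.comp_apply, Equiv.eq_symm_apply]

variable [DecidableEq M] [NeZero n]

theorem exists_forall_MMS_le_bundleVal (v : M → ℝ) :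
    ∃ f : M → Fin n, ∀ j, MMS n v ≤ bundleVal v f j := by
  obtain ⟨f, -, hf⟩ := Finset.exists_mem_eq_sup' Finset.univ_nonempty
    (fun f : M → Fin n => Finset.univ.inf' Finset.univ_nonempty fun j => bundleVal v f j)
  exact ⟨f, fun j => hf.le.trans (Finset.inf'_le _ (Finset.mem_univ j))⟩

/-- Every partition has a bundle worth at least the maximin share. -/
theorem exists_MMS_le_bundleVal (v : M → ℝ) (f : M → Fin n) :
    ∃ j, MMS n v ≤ bundleVal v f j := by
  obtain ⟨g, hg⟩ := exists_forall_MMS_le_bundleVal (n := n) v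
  obtain ⟨j, -, hj⟩ := Finset.exists_le_of_sum_le (s := Finset.univ) Finset.univ_nonempty
    (f := fun _ : Fin n => MMS n v) (g := bundleVal v f) <| by
      rw [sum_bundleVal, ← sum_bundleVal v g]
      exact Finset.sum_le_sum fun j _ => hg j
  exact ⟨j, hj⟩

end Shares

/-- If all but at most one of the n agents (with additive nonnegative
valuations) have the same valuation function, then an MMS allocation exists. -/
theorem exists_MMS_allocation_all_but_one_same (n : ℕ) [NeZero n] {M : Type*}
    [Fintype M] [DecidableEq M] (v : Fin n → M → ℝ) (hv : ∀ i e, 0 ≤ v i e)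
    (hsame : ∃ i0 : Fin n, ∀ i j : Fin n, i ≠ i0 → j ≠ i0 → v i = v j) :
    ∃ A : M → Fin n, ∀ i, MMS n (v i) ≤ bundleVal (v i) A i := by
  obtain ⟨i₀, hi₀⟩ := hsame
  obtain ⟨w, hw⟩ : ∃ w, ∀ i, i ≠ i₀ → v i = w := by
    by_cases h : ∃ j, j ≠ i₀
    · obtain ⟨j, hj⟩ := h
      exact ⟨v j, fun i hi => hi₀ i j hi hj⟩
    · exact ⟨v i₀, fun i hi => absurd ⟨i, hi⟩ h⟩
  obtain ⟨f, hf⟩ := exists_forall_MMS_le_bundleVal (n := n) w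
  obtain ⟨j, hj⟩ := exists_MMS_le_bundleVal (v i₀) f
  refine ⟨Equiv.swap i₀ j ∘ f, fun i => ?_⟩
  rw [bundleVal_perm_comp, Equiv.symm_swap]
  by_cases hi : i = i₀
  · rwa [hi, Equiv.swap_apply_left]
  · rw [hw i hi]
    exact hf _
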